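/- Let Ω, γ, α, L be as in the setup and assume both Green identities. Then for every M ∈ ℝ and every ψ : ℝ² → ℂ² that is C² with compact support, ∫_{ℝ²} |Tψ(x) + M σ₃ 1_{ℝ²∖Ω}(x) ψ(x)|² dx = ∫_{ℝ²} |∇ψ(x)|² dx + M² ∫_{ℝ²∖Ω} |ψ(x)|² dx − M ∫₀^L ( |P₊(α(s)) ψ(γ(s))|² − |P₋(α(s)) ψ(γ(s))|² ) ds, where 1_{ℝ²∖Ω} is the indicator function of the complement of Ω. -/

import Mathlib

open MeasureTheory

/-- first partial derivative of a complex-valued function on ℝ². -/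
noncomputable def d1 (f : ℝ × ℝ → ℂ) (x : ℝ × ℝ) : ℂ := fderiv ℝ f x (1, 0)

/-- second partial derivative of a complex-valued function on ℝ². -/
noncomputable def d2 (f : ℝ × ℝ → ℂ) (x : ℝ × ℝ) : ℂ := fderiv ℝ f x (0, 1)

/-- massless Dirac expression `T = (1/i)(σ₁ ∂₁ + σ₂ ∂₂)`, componentwise. -/
noncomputable def diracT (φ : ℝ × ℝ → ℂ × ℂ) (x : ℝ × ℝ) : ℂ × ℂ :=
  (-Complex.I * d1 (fun y => (φ y).2) x - d2 (fun y => (φ y).2) x,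
   -Complex.I * d1 (fun y => (φ y).1) x + d2 (fun y => (φ y).1) x)

/-- `|∇φ|² = Σ_{j=1,2} (|∂_jφ₁|² + |∂_jφ₂|²)`. -/
noncomputable def gradSq (φ : ℝ × ℝ → ℂ × ℂ) (x : ℝ × ℝ) : ℝ :=
  ‖d1 (fun y => (φ y).1) x‖ ^ 2 + ‖d1 (fun y => (φ y).2) x‖ ^ 2 +
    ‖d2 (fun y => (φ y).1) x‖ ^ 2 + ‖d2 (fun y => (φ y).2) x‖ ^ 2

/-- squared Euclidean norm on ℂ². -/
noncomputable def normSq2 (v : ℂ × ℂ) : ℝ := ‖v.1‖ ^ 2 + ‖v.2‖ ^ 2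

/-- `P₊(α) = (I + A(α))/2` acting on ℂ², where `A(α)` has zero diagonal,
upper-right entry `-i e^{-iα}` and lower-left entry `i e^{iα}`. -/
noncomputable def Pplus (a : ℝ) (v : ℂ × ℂ) : ℂ × ℂ :=
  ((v.1 + -Complex.I * Complex.exp (-(Complex.I * (a : ℂ))) * v.2) / 2,
   (v.2 + Complex.I * Complex.exp (Complex.I * (a : ℂ)) * v.1) / 2)

/-- `P₋(α) = (I - A(α))/2` acting on ℂ². -/
noncomputable def Pminus (a : ℝ) (v : ℂ × ℂ) : ℂ × ℂ :=
  ((v.1 - -Complex.I * Complex.exp (-(Complex.I * (a : ℂ))) * v.2) / 2,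
   (v.2 - Complex.I * Complex.exp (Complex.I * (a : ℂ)) * v.1) / 2)

/-- `M σ₃ 1_{ℝ²∖Ω} ψ` : the mass term, supported outside Ω. -/
noncomputable def massTerm (Ω : Set (ℝ × ℝ)) (M : ℝ) (ψ : ℝ × ℝ → ℂ × ℂ)
    (x : ℝ × ℝ) : ℂ × ℂ :=
  Set.indicator Ωᶜ (fun y => ((M : ℂ) * (ψ y).1, -(M : ℂ) * (ψ y).2)) x

open scoped ComplexConjugate

section PartialDerivatives

variable {f g : ℝ × ℝ → ℂ} {x : ℝ × ℝ}

theorem d1_mul (hf : DifferentiableAt ℝ f x) (hg : DifferentiableAt ℝ g x) :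
    d1 (fun y => f y * g y) x = f x * d1 g x + d1 f x * g x := by
  simp [d1, fderiv_fun_mul hf hg, mul_comm]

theorem d2_mul (hf : DifferentiableAt ℝ f x) (hg : DifferentiableAt ℝ g x) :
    d2 (fun y => f y * g y) x = f x * d2 g x + d2 f x * g x := by
  simp [d2, fderiv_fun_mul hf hg, mul_comm]

theorem d1_sub (hf : DifferentiableAt ℝ f x) (hg : DifferentiableAt ℝ g x) :
    d1 (fun y => f y - g y) x = d1 f x - d1 g x := by
  simp [d1, fderiv_fun_sub hf hg]

theorem d2_sub (hf : DifferentiableAt ℝ f x) (hg : DifferentiableAt ℝ g x) :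
    d2 (fun y => f y - g y) x = d2 f x - d2 g x := by
  simp [d2, fderiv_fun_sub hf hg]

theorem fderiv_conj_apply (hf : DifferentiableAt ℝ f x) (w : ℝ × ℝ) :
    fderiv ℝ (fun y => conj (f y)) x w = conj (fderiv ℝ f x w) := by
  have h := (Complex.conjCLE : ℂ →L[ℝ] ℂ).hasFDerivAt.comp x hf.hasFDerivAt
  exact congrArg (fun T : ℝ × ℝ →L[ℝ] ℂ => T w) h.fderiv

theorem d1_conj (hf : DifferentiableAt ℝ f x) :
    d1 (fun y => conj (f y)) x = conj (d1 f x) :=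
  fderiv_conj_apply hf _

theorem d2_conj (hf : DifferentiableAt ℝ f x) :
    d2 (fun y => conj (f y)) x = conj (d2 f x) :=
  fderiv_conj_apply hf _

theorem contDiff_d1 {m n : WithTop ℕ∞} (hf : ContDiff ℝ n f) (hmn : m + 1 ≤ n) :
    ContDiff ℝ m (d1 f) :=
  (hf.fderiv_right hmn).clm_apply contDiff_const

theorem contDiff_d2 {m n : WithTop ℕ∞} (hf : ContDiff ℝ n f) (hmn : m + 1 ≤ n) :
    ContDiff ℝ m (d2 f) :=
  (hf.fderiv_right hmn).clm_apply contDiff_const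

theorem continuous_d1 (hf : ContDiff ℝ 1 f) : Continuous (d1 f) :=
  (contDiff_d1 (m := 0) hf (by norm_num)).continuous

theorem continuous_d2 (hf : ContDiff ℝ 1 f) : Continuous (d2 f) :=
  (contDiff_d2 (m := 0) hf (by norm_num)).continuous

theorem hasCompactSupport_d1 (hf : HasCompactSupport f) : HasCompactSupport (d1 f) :=
  hf.fderiv_apply (𝕜 := ℝ) _

theorem hasCompactSupport_d2 (hf : HasCompactSupport f) : HasCompactSupport (d2 f) :=
  hf.fderiv_apply (𝕜 := ℝ) _

theorem d1_d2_comm (hf : ContDiff ℝ 2 f) : d1 (d2 f) x = d2 (d1 f) x := by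
  have hd : DifferentiableAt ℝ (fderiv ℝ f) x :=
    ((hf.fderiv_right (m := 1) (by norm_num)).differentiable (by norm_num)) x
  have key : ∀ v w : ℝ × ℝ,
      fderiv ℝ (fun y => fderiv ℝ f y v) x w = fderiv ℝ (fderiv ℝ f) x w v := fun v w => by
    rw [fderiv_clm_apply hd (differentiableAt_const v)]
    simp
  have hs : IsSymmSndFDerivAt ℝ f x := hf.contDiffAt.isSymmSndFDerivAt (by simp)
  exact (key _ _).trans ((hs _ _).trans (key _ _).symm)

end PartialDerivatives

/-- The divergence of a complexified vector field on ℝ². -/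
noncomputable def divergence (F : ℝ × ℝ → ℂ × ℂ) (x : ℝ × ℝ) : ℂ :=
  d1 (fun y => (F y).1) x + d2 (fun y => (F y).2) x

theorem integrable_divergence {F : ℝ × ℝ → ℂ × ℂ} (hF : ContDiff ℝ 1 F)
    (hc : HasCompactSupport F) : Integrable (divergence F) := by
  have h1 : HasCompactSupport (fun y => (F y).1) := hc.comp_left (g := Prod.fst) rfl
  have h2 : HasCompactSupport (fun y => (F y).2) := hc.comp_left (g := Prod.snd) rfl
  exact ((continuous_d1 hF.fst).add (continuous_d2 hF.snd)).integrable_of_hasCompactSupport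
    ((hasCompactSupport_d1 h1).add (hasCompactSupport_d2 h2))

/-- The vector field `(ψ₁ ∂₂ψ̄₁ - ψ₂ ∂₂ψ̄₂, ψ₂ ∂₁ψ̄₂ - ψ₁ ∂₁ψ̄₁)`, whose divergence
measures the difference between `|Tψ|²` and `|∇ψ|²`. -/
noncomputable def nullField (ψ : ℝ × ℝ → ℂ × ℂ) (x : ℝ × ℝ) : ℂ × ℂ :=
  ((ψ x).1 * conj (d2 (fun y => (ψ y).1) x) - (ψ x).2 * conj (d2 (fun y => (ψ y).2) x),
   (ψ x).2 * conj (d1 (fun y => (ψ y).2) x) - (ψ x).1 * conj (d1 (fun y => (ψ y).1) x))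

/-- The vector field `(-i ψ₂ ψ̄₁, -ψ₂ ψ̄₁)`, whose divergence gives the cross term between
`Tψ` and `σ₃ψ`. -/
noncomputable def crossField (ψ : ℝ × ℝ → ℂ × ℂ) (x : ℝ × ℝ) : ℂ × ℂ :=
  (-Complex.I * ((ψ x).2 * conj (ψ x).1), (-1 : ℂ) * ((ψ x).2 * conj (ψ x).1))

section Fields

variable {ψ : ℝ × ℝ → ℂ × ℂ}

theorem contDiff_nullField (hψ : ContDiff ℝ 2 ψ) : ContDiff ℝ 1 (nullField ψ) := by
  have hc : ContDiff ℝ 1 (fun z : ℂ => conj z) := Complex.conjCLE.contDiff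
  have h11 := hc.comp (contDiff_d1 (m := 1) hψ.fst (by norm_num))
  have h12 := hc.comp (contDiff_d2 (m := 1) hψ.fst (by norm_num))
  have h21 := hc.comp (contDiff_d1 (m := 1) hψ.snd (by norm_num))
  have h22 := hc.comp (contDiff_d2 (m := 1) hψ.snd (by norm_num))
  have h1 : ContDiff ℝ 1 ψ := hψ.of_le (by norm_num)
  exact ((h1.fst.mul h12).sub (h1.snd.mul h22)).prodMk ((h1.snd.mul h21).sub (h1.fst.mul h11))

theorem contDiff_crossField {n : WithTop ℕ∞} (hψ : ContDiff ℝ n ψ) :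
    ContDiff ℝ n (crossField ψ) := by
  have hc : ContDiff ℝ n (fun z : ℂ => conj z) := Complex.conjCLE.contDiff
  have h := hψ.snd.mul (hc.comp hψ.fst)
  exact (contDiff_const.mul h).prodMk (contDiff_const.mul h)

theorem hasCompactSupport_nullField (hc : HasCompactSupport ψ) :
    HasCompactSupport (nullField ψ) :=
  hc.mono fun x hx h => hx (by simp [nullField, h])

theorem hasCompactSupport_crossField (hc : HasCompactSupport ψ) :
    HasCompactSupport (crossField ψ) :=
  hc.mono fun x hx h => hx (by simp [crossField, h])

theorem divergence_nullField (hψ : ContDiff ℝ 2 ψ) (x : ℝ × ℝ) :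
    divergence (nullField ψ) x =
      (d1 (fun y => (ψ y).1) x * conj (d2 (fun y => (ψ y).1) x)
        - d2 (fun y => (ψ y).1) x * conj (d1 (fun y => (ψ y).1) x))
      - (d1 (fun y => (ψ y).2) x * conj (d2 (fun y => (ψ y).2) x)
        - d2 (fun y => (ψ y).2) x * conj (d1 (fun y => (ψ y).2) x)) := by
  have hu : ContDiff ℝ 2 fun y => (ψ y).1 := hψ.fst
  have hv : ContDiff ℝ 2 fun y => (ψ y).2 := hψ.snd
  have du := hu.differentiable (by norm_num) x
  have dv := hv.differentiable (by norm_num) x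
  have du1 := (contDiff_d1 (m := 1) hu (by norm_num)).differentiable (by norm_num) x
  have du2 := (contDiff_d2 (m := 1) hu (by norm_num)).differentiable (by norm_num) x
  have dv1 := (contDiff_d1 (m := 1) hv (by norm_num)).differentiable (by norm_num) x
  have dv2 := (contDiff_d2 (m := 1) hv (by norm_num)).differentiable (by norm_num) x
  have cu1 : DifferentiableAt ℝ (fun y => conj (d1 (fun y => (ψ y).1) y)) x := du1.star
  have cu2 : DifferentiableAt ℝ (fun y => conj (d2 (fun y => (ψ y).1) y)) x := du2.star
  have cv1 : DifferentiableAt ℝ (fun y => conj (d1 (fun y => (ψ y).2) y)) x := dv1.star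
  have cv2 : DifferentiableAt ℝ (fun y => conj (d2 (fun y => (ψ y).2) y)) x := dv2.star
  simp only [divergence, nullField]
  rw [d1_sub (du.fun_mul cu2) (dv.fun_mul cv2), d2_sub (dv.fun_mul cv1) (du.fun_mul cu1),
    d1_mul du cu2, d1_mul dv cv2, d2_mul dv cv1, d2_mul du cu1, d1_conj du2, d1_conj dv2,
    d2_conj du1, d2_conj dv1, d1_d2_comm hu, d1_d2_comm hv]
  ring

theorem divergence_crossField (hψ : Differentiable ℝ ψ) (x : ℝ × ℝ) :
    divergence (crossField ψ) x =
      -Complex.I * ((ψ x).2 * conj (d1 (fun y => (ψ y).1) x)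
        + d1 (fun y => (ψ y).2) x * conj (ψ x).1)
      - ((ψ x).2 * conj (d2 (fun y => (ψ y).1) x)
        + d2 (fun y => (ψ y).2) x * conj (ψ x).1) := by
  have du : DifferentiableAt ℝ (fun y => (ψ y).1) x := (hψ x).fst
  have dv : DifferentiableAt ℝ (fun y => (ψ y).2) x := (hψ x).snd
  have cu : DifferentiableAt ℝ (fun y => conj (ψ y).1) x := du.star
  have e1 : ∀ c : ℂ, d1 (fun _ => c) x = 0 := fun c => by simp [d1]
  have e2 : ∀ c : ℂ, d2 (fun _ => c) x = 0 := fun c => by simp [d2]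
  simp only [divergence, crossField]
  rw [d1_mul (differentiableAt_const _) (dv.fun_mul cu),
    d2_mul (differentiableAt_const _) (dv.fun_mul cu), d1_mul dv cu, d2_mul dv cu,
    d1_conj du, d2_conj du, e1, e2]
  ring

theorem normSq2_diracT_add_massTerm (hψ : ContDiff ℝ 2 ψ) (Ω : Set (ℝ × ℝ)) (M : ℝ)
    (x : ℝ × ℝ) :
    normSq2 (diracT ψ x + massTerm Ω M ψ x) =
      gradSq ψ x + (divergence (nullField ψ) x).im +
        Ωᶜ.indicator
          (fun y => M ^ 2 * normSq2 (ψ y) + 2 * M * (divergence (crossField ψ) y).re) x := by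
  rw [divergence_nullField hψ]
  by_cases hx : x ∈ Ωᶜ
  · rw [massTerm, Set.indicator_of_mem hx, Set.indicator_of_mem hx,
      divergence_crossField (hψ.differentiable (by norm_num))]
    simp only [normSq2, diracT, gradSq, ← Complex.normSq_eq_norm_sq, Complex.normSq_apply]
    simp
    ring
  · rw [massTerm, Set.indicator_of_notMem hx, Set.indicator_of_notMem hx]
    simp only [normSq2, diracT, gradSq, ← Complex.normSq_eq_norm_sq, Complex.normSq_apply]
    simp
    ring

theorem continuous_gradSq (hψ : ContDiff ℝ 1 ψ) : Continuous (gradSq ψ) := by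
  have h11 := continuous_d1 hψ.fst
  have h12 := continuous_d2 hψ.fst
  have h21 := continuous_d1 hψ.snd
  have h22 := continuous_d2 hψ.snd
  unfold gradSq
  fun_prop

theorem integrable_gradSq (hψ : ContDiff ℝ 1 ψ) (hc : HasCompactSupport ψ) :
    Integrable (gradSq ψ) := by
  have h1 : HasCompactSupport (fun y => (ψ y).1) := hc.comp_left (g := Prod.fst) rfl
  have h2 : HasCompactSupport (fun y => (ψ y).2) := hc.comp_left (g := Prod.snd) rfl
  have hsq : ∀ {f : ℝ × ℝ → ℂ}, HasCompactSupport f →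
      HasCompactSupport fun x => ‖f x‖ ^ 2 := fun h =>
    h.comp_left (g := fun z : ℂ => ‖z‖ ^ 2) (by simp)
  exact (continuous_gradSq hψ).integrable_of_hasCompactSupport
    ((((hsq (hasCompactSupport_d1 h1)).add (hsq (hasCompactSupport_d1 h2))).add
      (hsq (hasCompactSupport_d2 h1))).add (hsq (hasCompactSupport_d2 h2)))

theorem integrable_normSq2 (hψ : Continuous ψ) (hc : HasCompactSupport ψ) :
    Integrable fun x => normSq2 (ψ x) := by
  refine Continuous.integrable_of_hasCompactSupport ?_
    (hc.comp_left (g := normSq2) (by simp [normSq2]))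
  unfold normSq2
  fun_prop

theorem two_mul_re_flux_crossField (a : ℝ) (x : ℝ × ℝ) :
    2 * ((crossField ψ x).1 * (Real.cos a : ℂ) + (crossField ψ x).2 * (Real.sin a : ℂ)).re =
      normSq2 (Pplus a (ψ x)) - normSq2 (Pminus a (ψ x)) := by
  have e1 : Complex.exp (Complex.I * a) = Real.cos a + Real.sin a * Complex.I := by
    rw [mul_comm, Complex.exp_mul_I]
    simp
  have e2 : Complex.exp (-(Complex.I * a)) = Real.cos a - Real.sin a * Complex.I := by
    rw [← mul_neg, mul_comm, Complex.exp_mul_I, Complex.cos_neg, Complex.sin_neg]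
    simp [sub_eq_add_neg]
  have hdiv : ∀ z : ℂ, z / 2 = ((1 / 2 : ℝ) : ℂ) * z := fun z => by
    push_cast
    ring
  simp only [crossField, normSq2, Pplus, Pminus, e1, e2, hdiv, ← Complex.normSq_eq_norm_sq,
    Complex.normSq_apply, Complex.add_re, Complex.add_im, Complex.sub_re, Complex.sub_im,
    Complex.mul_re, Complex.mul_im, Complex.neg_re, Complex.neg_im, Complex.I_re, Complex.I_im,
    Complex.ofReal_re, Complex.ofReal_im, Complex.conj_re, Complex.conj_im, Complex.one_re,
    Complex.one_im]
  ring

end Fields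

theorem energy_identity_H_M
    (Ω : Set (ℝ × ℝ)) (hΩopen : IsOpen Ω) (hΩbdd : Bornology.IsBounded Ω)
    (hΩconn : IsConnected Ω)
    (L : ℝ) (hL : 0 < L)
    (γ : ℝ → ℝ × ℝ) (α : ℝ → ℝ)
    (hγC : ContDiff ℝ 3 γ) (hαC : ContDiff ℝ 2 α)
    (hper : ∀ s, γ (s + L) = γ s)
    (hinj : Set.InjOn γ (Set.Ico 0 L))
    (hbdry : frontier Ω = γ '' Set.Icc 0 L)
    (hγ' : ∀ s, deriv γ s = (-Real.sin (α s), Real.cos (α s)))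
    -- interior Green identity
    (hGreenIn : ∀ F : ℝ × ℝ → ℂ × ℂ, ∀ U : Set (ℝ × ℝ), IsOpen U → closure Ω ⊆ U →
      ContDiffOn ℝ 1 F U →
      (∫ x in Ω, (d1 (fun y => (F y).1) x + d2 (fun y => (F y).2) x)) =
        ∫ s in (0:ℝ)..L,
          ((F (γ s)).1 * (Real.cos (α s) : ℂ) + (F (γ s)).2 * (Real.sin (α s) : ℂ)))
    -- exterior Green identity
    (hGreenOut : ∀ F : ℝ × ℝ → ℂ × ℂ, ContDiff ℝ 1 F → HasCompactSupport F →
      (∫ x in Ωᶜ, (d1 (fun y => (F y).1) x + d2 (fun y => (F y).2) x)) =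
        -∫ s in (0:ℝ)..L,
          ((F (γ s)).1 * (Real.cos (α s) : ℂ) + (F (γ s)).2 * (Real.sin (α s) : ℂ)))
    (M : ℝ)
    (ψ : ℝ × ℝ → ℂ × ℂ) (hψ : ContDiff ℝ 2 ψ) (hsupp : HasCompactSupport ψ) :
    (∫ x, normSq2 (diracT ψ x + massTerm Ω M ψ x)) =
      (∫ x, gradSq ψ x) + M ^ 2 * (∫ x in Ωᶜ, normSq2 (ψ x)) -
        M * ∫ s in (0:ℝ)..L,
          (normSq2 (Pplus (α s) (ψ (γ s))) - normSq2 (Pminus (α s) (ψ (γ s)))) := by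
  have hψ1 : ContDiff ℝ 1 ψ := hψ.of_le (by norm_num)
  have hN := contDiff_nullField hψ
  have hNc := hasCompactSupport_nullField hsupp
  have hNi := integrable_divergence hN hNc
  have hC := contDiff_crossField hψ1
  have hCc := hasCompactSupport_crossField hsupp
  have hCi := integrable_divergence hC hCc
  have hψi := integrable_normSq2 hψ.continuous hsupp
  have hGi := integrable_gradSq hψ1 hsupp
  have hNim : Integrable fun x => (divergence (nullField ψ) x).im := hNi.im
  have hCre : Integrable fun x => (divergence (crossField ψ) x).re := hCi.re
  have hnull : ∫ x, (divergence (nullField ψ) x).im = 0 := by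
    have h : ∫ x, divergence (nullField ψ) x = 0 := by
      rw [← integral_add_compl hΩopen.measurableSet hNi]
      exact (congrArg₂ (· + ·)
        (hGreenIn _ Set.univ isOpen_univ (Set.subset_univ _) hN.contDiffOn)
        (hGreenOut _ hN hNc)).trans (add_neg_cancel _)
    exact (Complex.imCLM.integral_comp_comm hNi).trans (by simp [h])
  have hcross : 2 * ∫ x in Ωᶜ, (divergence (crossField ψ) x).re =
      -∫ s in (0:ℝ)..L,
        (normSq2 (Pplus (α s) (ψ (γ s))) - normSq2 (Pminus (α s) (ψ (γ s)))) := by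
    have hre : ∫ x in Ωᶜ, (divergence (crossField ψ) x).re =
        (∫ x in Ωᶜ, divergence (crossField ψ) x).re :=
      Complex.reCLM.integral_comp_comm hCi.integrableOn
    have hcont : Continuous fun s => (crossField ψ (γ s)).1 * (Real.cos (α s) : ℂ) +
        (crossField ψ (γ s)).2 * (Real.sin (α s) : ℂ) := by
      have h1 := hC.continuous.comp hγC.continuous
      have h2 := hαC.continuous
      have h3 : Continuous fun s => (crossField ψ (γ s)).1 := continuous_fst.comp h1
      have h4 : Continuous fun s => (crossField ψ (γ s)).2 := continuous_snd.comp h1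
      fun_prop
    have hflux := Complex.reCLM.intervalIntegral_comp_comm
      (hcont.intervalIntegrable (μ := volume) 0 L)
    simp only [Complex.reCLM_apply] at hflux
    simp_rw [← two_mul_re_flux_crossField]
    rw [intervalIntegral.integral_const_mul, hflux, hre, ← mul_neg, ← Complex.neg_re]
    exact congrArg (fun z : ℂ => 2 * z.re) (hGreenOut _ hC hCc)
  have hin : Integrable fun x => gradSq ψ x + (divergence (nullField ψ) x).im := hGi.add hNim
  have hout : Integrable fun y =>
      M ^ 2 * normSq2 (ψ y) + 2 * M * (divergence (crossField ψ) y).re :=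
    (hψi.const_mul _).add (hCre.const_mul _)
  simp_rw [normSq2_diracT_add_massTerm hψ]
  rw [integral_add hin (hout.indicator hΩopen.measurableSet.compl),
    integral_add hGi hNim, integral_indicator hΩopen.measurableSet.compl,
    integral_add (hψi.const_mul _).integrableOn (hCre.const_mul _).integrableOn,
    integral_const_mul, integral_const_mul, hnull]
  linear_combination M * hcross
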